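/- Fix n ∈ ℕ, and for natural numbers h, k with h + k = n let Q(h,k) = ℝ^h × [0,∞)^k ⊆ ℝⁿ. Let h₁ + k₁ = h₂ + k₂ = n, let V₁, V₂ ⊆ ℝⁿ be open sets, and let F : V₁ → V₂ be a bijection such that both F and F⁻¹ are infinitely differentiable (C^∞) and F(V₁ ∩ Q(h₁,k₁)) = V₂ ∩ Q(h₂,k₂). Then for every x ∈ V₁ ∩ Q(h₁,k₁), the number of indices i with h₁ < i ≤ n and x_i = 0 equals the number of indices i with h₂ < i ≤ n and (F(x))_i = 0. -/

import Mathlib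

open scoped Classical

/-- The quadrant `Q(h,k) = ℝ^h × [0,∞)^k ⊆ ℝⁿ` (with `h + k = n`): the set of points whose
last `k` coordinates are nonnegative. -/
def Quadrant (n h : ℕ) : Set (Fin n → ℝ) :=
  {x | ∀ i : Fin n, h ≤ (i : ℕ) → 0 ≤ x i}

/-- If a surjective linear map carries the coordinate subspace `{v | ∀ i, p i → v i = 0}` into
`{w | ∀ j, q j → w j = 0}`, then the codimension of the latter is at most that of the former. -/
theorem card_filter_le_of_surjective_of_vanish {ι κ : Type*} [Fintype ι] [Fintype κ]
    (p : ι → Prop) (q : κ → Prop)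
    [DecidablePred p] [DecidablePred q] (A : (ι → ℝ) →ₗ[ℝ] (κ → ℝ)) (hA : Function.Surjective A)
    (h : ∀ v : ι → ℝ, (∀ i, p i → v i = 0) → ∀ j, q j → A v j = 0) :
    (Finset.univ.filter q).card ≤ (Finset.univ.filter p).card := by
  let E : ({i // p i} → ℝ) →ₗ[ℝ] (ι → ℝ) :=
    { toFun := fun u i => if hi : p i then u ⟨i, hi⟩ else 0
      map_add' := fun u v => by ext i; by_cases hi : p i <;> simp [hi]
      map_smul' := fun c u => by ext i; by_cases hi : p i <;> simp [hi] }
  let R : (κ → ℝ) →ₗ[ℝ] ({j // q j} → ℝ) := LinearMap.funLeft ℝ ℝ Subtype.val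
  have hsurj : Function.Surjective (R ∘ₗ A ∘ₗ E) := by
    intro w
    obtain ⟨v, hv⟩ := hA (fun j => if hj : q j then w ⟨j, hj⟩ else 0)
    refine ⟨fun i => v i, ?_⟩
    ext ⟨j, hj⟩
    have hdiff := h (v - E fun i => v i) (fun i hi => by simp [E, hi]) j hj
    rw [map_sub, Pi.sub_apply, sub_eq_zero, hv] at hdiff
    exact hdiff.symm.trans (dif_pos hj)
  have hrank := LinearMap.finrank_le_finrank_of_surjective hsurj
  simpa [Fintype.card_subtype] using hrank

/-- Moving from `x` in a direction tangent to its corner stratum stays in the quadrant for a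
short time. -/
theorem eventually_add_smul_mem_quadrant {n h : ℕ} {x v : Fin n → ℝ} (hx : x ∈ Quadrant n h)
    (hv : ∀ i : Fin n, h ≤ (i : ℕ) ∧ x i = 0 → v i = 0) :
    ∀ᶠ t : ℝ in nhds 0, x + t • v ∈ Quadrant n h := by
  refine Filter.eventually_all.2 fun i => ?_
  by_cases hi : h ≤ (i : ℕ)
  · rcases (hx i hi).eq_or_lt with h0 | hpos
    · exact .of_forall fun t _ => by simp [← h0, hv i ⟨hi, h0.symm⟩]
    · have hc : ContinuousAt (fun t : ℝ => (x + t • v) i) 0 := by fun_prop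
      filter_upwards [hc.eventually_const_lt (by simpa using hpos)] with t ht _ using ht.le
  · exact .of_forall fun t hi' => absurd hi' hi

/-- If `F` maps a neighbourhood of `x` in a quadrant into a quadrant, then its derivative at `x`
carries the tangent space of the corner stratum of `x` into that of `F x`. -/
theorem fderiv_apply_eq_zero_of_mapsTo_quadrant {m n h₁ h₂ : ℕ} {V : Set (Fin m → ℝ)}
    {F : (Fin m → ℝ) → (Fin n → ℝ)} {A : (Fin m → ℝ) →L[ℝ] (Fin n → ℝ)} {x : Fin m → ℝ}
    (hV : V ∈ nhds x) (hx : x ∈ Quadrant m h₁) (hF : HasFDerivAt F A x)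
    (hFQ : Set.MapsTo F (V ∩ Quadrant m h₁) (Quadrant n h₂)) {v : Fin m → ℝ}
    (hv : ∀ i : Fin m, h₁ ≤ (i : ℕ) ∧ x i = 0 → v i = 0) {j : Fin n}
    (hj : h₂ ≤ (j : ℕ) ∧ F x j = 0) : A v j = 0 := by
  have hline : HasDerivAt (fun t : ℝ => x + t • v) v 0 := by
    simpa using ((hasDerivAt_id (0 : ℝ)).smul_const v).const_add x
  have hx0 : x + (0 : ℝ) • v = x := by simp
  have hderiv : HasDerivAt (fun t : ℝ => F (x + t • v) j) (A v j) 0 :=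
    hasDerivAt_pi.1 ((hx0.symm ▸ hF : HasFDerivAt F A (x + (0 : ℝ) • v)).comp_hasDerivAt 0 hline) j
  have hmem : ∀ᶠ t : ℝ in nhds 0, x + t • v ∈ V :=
    hline.continuousAt.eventually_mem (by rwa [hx0])
  refine IsLocalMin.hasDerivAt_eq_zero ?_ hderiv
  filter_upwards [hmem, eventually_add_smul_mem_quadrant hx hv] with t htV htQ
  simpa only [hx0, hj.2] using hFQ ⟨htV, htQ⟩ j hj.1

/-- A local diffeomorphism at `x` mapping a quadrant into a quadrant does not increase the
number of vanishing quadrant coordinates. -/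
theorem corner_codim_le {n h₁ h₂ : ℕ} {V₁ V₂ : Set (Fin n → ℝ)} (hV₁ : IsOpen V₁)
    (hV₂ : IsOpen V₂) {F G : (Fin n → ℝ) → (Fin n → ℝ)} (hF : DifferentiableOn ℝ F V₁)
    (hG : DifferentiableOn ℝ G V₂) (hFV : Set.MapsTo F V₁ V₂)
    (hGF : ∀ x ∈ V₁, G (F x) = x) (hFG : ∀ y ∈ V₂, F (G y) = y)
    (hFQ : Set.MapsTo F (V₁ ∩ Quadrant n h₁) (Quadrant n h₂))
    {x : Fin n → ℝ} (hx : x ∈ V₁ ∩ Quadrant n h₁) :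
    (Finset.univ.filter fun i : Fin n => h₂ ≤ (i : ℕ) ∧ F x i = 0).card ≤
      (Finset.univ.filter fun i : Fin n => h₁ ≤ (i : ℕ) ∧ x i = 0).card := by
  have hV₁x := hV₁.mem_nhds hx.1
  have hV₂x := hV₂.mem_nhds (hFV hx.1)
  have hFx := (hF.differentiableAt hV₁x).hasFDerivAt
  have hGx := (hG.differentiableAt hV₂x).hasFDerivAt
  have hcomp : HasFDerivAt (F ∘ G) ((fderiv ℝ F x).comp (fderiv ℝ G (F x))) (F x) :=
    HasFDerivAt.comp (F x) (by simpa only [hGF x hx.1] using hFx) hGx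
  have hid : HasFDerivAt (F ∘ G) (ContinuousLinearMap.id ℝ (Fin n → ℝ)) (F x) :=
    (hasFDerivAt_id (F x)).congr_of_eventuallyEq (Filter.mem_of_superset hV₂x hFG)
  have hinv := hcomp.unique hid
  exact card_filter_le_of_surjective_of_vanish _ _ (fderiv ℝ F x).toLinearMap
    (fun w => ⟨fderiv ℝ G (F x) w, congrArg (fun L => L w) hinv⟩)
    fun _ hv _ hj => fderiv_apply_eq_zero_of_mapsTo_quadrant hV₁x hx.2 hFx hFQ hv hj

/-- **Chart-independence of the corner codimension.** Fix `n`, and let `h₁ + k₁ = n`,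
`h₂ + k₂ = n`. Let `V₁, V₂ ⊆ ℝⁿ` be open, and let `F : V₁ → V₂` be a bijection (with
inverse `G`) such that both `F` and `G` are `C^∞` and `F(V₁ ∩ Q(h₁,k₁)) = V₂ ∩ Q(h₂,k₂)`.
Then for every `x ∈ V₁ ∩ Q(h₁,k₁)`, the number of quadrant coordinates of `x` (indices
`i ≥ h₁`) vanishing at `x` equals the number of quadrant coordinates (indices `i ≥ h₂`)
of `F x` vanishing at `F x`. -/
theorem corner_codim_chart_independent (n h₁ k₁ h₂ k₂ : ℕ)
    (hn₁ : h₁ + k₁ = n) (hn₂ : h₂ + k₂ = n)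
    (V₁ V₂ : Set (Fin n → ℝ)) (hV₁ : IsOpen V₁) (hV₂ : IsOpen V₂)
    (F G : (Fin n → ℝ) → (Fin n → ℝ))
    (hF : ContDiffOn ℝ (⊤ : ℕ∞) F V₁) (hG : ContDiffOn ℝ (⊤ : ℕ∞) G V₂)
    (hFV : Set.MapsTo F V₁ V₂) (hGV : Set.MapsTo G V₂ V₁)
    (hGF : ∀ x ∈ V₁, G (F x) = x) (hFG : ∀ y ∈ V₂, F (G y) = y)
    (hQ : F '' (V₁ ∩ Quadrant n h₁) = V₂ ∩ Quadrant n h₂) :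
    ∀ x ∈ V₁ ∩ Quadrant n h₁,
      (Finset.univ.filter fun i : Fin n => h₁ ≤ (i : ℕ) ∧ x i = 0).card =
      (Finset.univ.filter fun i : Fin n => h₂ ≤ (i : ℕ) ∧ F x i = 0).card := by
  intro x hx
  have hFQ : Set.MapsTo F (V₁ ∩ Quadrant n h₁) (V₂ ∩ Quadrant n h₂) := hQ ▸ Set.mapsTo_image _ _
  have hGQ : Set.MapsTo G (V₂ ∩ Quadrant n h₂) (Quadrant n h₁) := by
    rw [← hQ]
    rintro _ ⟨y, hy, rfl⟩
    rw [hGF y hy.1]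
    exact hy.2
  have hF' := hF.differentiableOn (by simp)
  have hG' := hG.differentiableOn (by simp)
  refine le_antisymm ?_ (corner_codim_le hV₁ hV₂ hF' hG' hFV hGF hFG
    (fun y hy => (hFQ hy).2) hx)
  simpa only [hGF x hx.1] using corner_codim_le hV₂ hV₁ hG' hF' hGV hFG hGF hGQ (hFQ hx)
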